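/- Let n and H be positive integers and let a, b be integers. Let c : ℤ → ℂ be a function such that c(k) = 0 whenever |k| > H or k is a nonzero even integer, c(0) is real, c(k) is purely imaginary for every odd integer k, and c(−k) = conj(c(k)) for every integer k (so that f(x) = Σ_{|h|≤H} c(h) e^{2πi h x} is real-valued). Then Σ_{g ∈ (ℤ/n)^*} f(ag/n) f(bg/n) f(g/n) = c(0)³·φ(n) + c(0)·[ Σ_{0<|h_2|≤H, 0<|h_3|≤H} c(h_2) c(h_3) c_n(b h_2 + h_3) + Σ_{0<|h_1|≤H, 0<|h_3|≤H} c(h_3) c(h_1) c_n(a h_1 + h_3) + Σ_{0<|h_1|≤H, 0<|h_2|≤H} c(h_1) c(h_2) c_n(a h_1 + b h_2) ]. -/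

import Mathlib

/-- The Ramanujan sum `c_n(m) = Σ_{g ∈ (ℤ/n)^*} e^{2πi m g / n}`, where `g` runs over the
least non-negative residues of the units of `ℤ/n`. (Junk value `0` when `n = 0`.) -/
noncomputable def ramanujanSum (n : ℕ) (m : ℤ) : ℂ :=
  if h : n = 0 then 0
  else
    haveI : NeZero n := ⟨h⟩
    ∑ g : (ZMod n)ˣ,
      Complex.exp (2 * (Real.pi : ℂ) * Complex.I * (m : ℂ) * (((g : ZMod n).val : ℕ) : ℂ) / (n : ℂ))

/-- The Ramanujan sum as a sum of values of the standard additive character. -/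
lemma ramanujanSum_eq_sum_stdAddChar (n : ℕ) [NeZero n] (m : ℤ) :
    ramanujanSum n m = ∑ g : (ZMod n)ˣ, ZMod.stdAddChar ((m : ZMod n) * (g : ZMod n)) := by
  rw [ramanujanSum, dif_neg (NeZero.ne n)]
  refine Finset.sum_congr rfl fun g _ => ?_
  have h : (m : ZMod n) * (g : ZMod n) = ((m * ((g : ZMod n).val : ℤ) : ℤ) : ZMod n) := by
    push_cast
    rw [ZMod.natCast_zmod_val]
  rw [h, ZMod.stdAddChar_coe]
  congr 1
  push_cast
  ring

/-- The trigonometric polynomial on `ZMod n` with coefficients `c` and frequencies in `S`. -/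
noncomputable def zmodTrigPoly (n : ℕ) [NeZero n] (S : Finset ℤ) (c : ℤ → ℂ) (x : ZMod n) : ℂ :=
  ∑ h ∈ S, c h * ZMod.stdAddChar ((h : ZMod n) * x)

lemma zmodTrigPoly_neg {n : ℕ} [NeZero n] {S : Finset ℤ} {c : ℤ → ℂ}
    (hS : ∀ h ∈ S, -h ∈ S) (hc : ∀ h ∈ S, c (-h) = -c h) (x : ZMod n) :
    zmodTrigPoly n S c (-x) = -zmodTrigPoly n S c x := by
  rw [zmodTrigPoly, zmodTrigPoly, ← Finset.sum_neg_distrib]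
  refine Finset.sum_nbij' (fun h => -h) (fun h => -h) hS hS (fun _ _ => neg_neg _)
    (fun _ _ => neg_neg _) fun h hh => ?_
  rw [hc h hh]
  push_cast
  rw [neg_mul, neg_mul_comm, neg_neg]

lemma sum_units_eq_zero_of_odd {n : ℕ} [NeZero n] {f : (ZMod n)ˣ → ℂ}
    (hf : ∀ g, f (-g) = -f g) : ∑ g, f g = 0 := by
  have h : ∑ g, f g = -∑ g, f g := by
    rw [← Finset.sum_neg_distrib, ← Equiv.sum_comp (Equiv.neg _) f]
    exact Finset.sum_congr rfl fun g _ => hf g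
  exact self_eq_neg.mp h

lemma sum_units_zmodTrigPoly_mul (n : ℕ) [NeZero n] (S : Finset ℤ) (c : ℤ → ℂ) (a b : ℤ) :
    ∑ g : (ZMod n)ˣ, zmodTrigPoly n S c (a * g) * zmodTrigPoly n S c (b * g)
      = ∑ p ∈ S ×ˢ S, c p.1 * c p.2 * ramanujanSum n (a * p.1 + b * p.2) := by
  simp_rw [zmodTrigPoly, Finset.sum_mul_sum, ← Finset.sum_product']
  rw [Finset.sum_product_right]
  refine Finset.sum_congr rfl fun p _ => ?_
  rw [ramanujanSum_eq_sum_stdAddChar, Finset.mul_sum]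
  refine Finset.sum_congr rfl fun g _ => ?_
  rw [mul_mul_mul_comm, ← AddChar.map_add_eq_mul]
  congr 2
  push_cast
  ring

theorem stmt13 (n : ℕ) [NeZero n] (H : ℕ) (hH : 0 < H) (a b : ℤ)
    (c : ℤ → ℂ)
    (hsupp : ∀ k : ℤ, (H : ℤ) < |k| → c k = 0)
    (heven : ∀ k : ℤ, k ≠ 0 → Even k → c k = 0)
    (hzero : (c 0).im = 0)
    (hodd : ∀ k : ℤ, Odd k → (c k).re = 0)
    (hconj : ∀ k : ℤ, c (-k) = (starRingEnd ℂ) (c k))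
    (F : ℝ → ℂ)
    (hF : ∀ x : ℝ, F x = ∑ h ∈ Finset.Icc (-(H : ℤ)) H,
      c h * Complex.exp (2 * (Real.pi : ℂ) * Complex.I * (h : ℂ) * (x : ℂ))) :
    ∑ g : (ZMod n)ˣ,
        F ((a : ℝ) * ((g : ZMod n).val : ℝ) / n) * F ((b : ℝ) * ((g : ZMod n).val : ℝ) / n) *
          F (((g : ZMod n).val : ℝ) / n)
      = (c 0) ^ 3 * (Nat.totient n : ℂ)
        + c 0 *
          ((∑ p ∈ ((Finset.Icc (-(H : ℤ)) H).erase 0) ×ˢ ((Finset.Icc (-(H : ℤ)) H).erase 0),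
              c p.1 * c p.2 * ramanujanSum n (b * p.1 + p.2))
            + (∑ p ∈ ((Finset.Icc (-(H : ℤ)) H).erase 0) ×ˢ ((Finset.Icc (-(H : ℤ)) H).erase 0),
              c p.2 * c p.1 * ramanujanSum n (a * p.1 + p.2))
            + (∑ p ∈ ((Finset.Icc (-(H : ℤ)) H).erase 0) ×ˢ ((Finset.Icc (-(H : ℤ)) H).erase 0),
              c p.1 * c p.2 * ramanujanSum n (a * p.1 + b * p.2))) := by
  set S := (Finset.Icc (-(H : ℤ)) H).erase 0 with hSdef
  have hS : ∀ h ∈ S, -h ∈ S := fun h hh => by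
    simp only [hSdef, Finset.mem_erase, Finset.mem_Icc] at hh ⊢
    omega
  have hc : ∀ h ∈ S, c (-h) = -c h := fun h hh => by
    rw [hconj]
    rcases Int.even_or_odd h with he | ho
    · simp [heven h (Finset.ne_of_mem_erase hh) he]
    · apply Complex.ext <;> simp [hodd h ho]
  have hFG : ∀ (m : ℤ) (g : (ZMod n)ˣ),
      F ((m : ℝ) * ((g : ZMod n).val : ℝ) / n) = c 0 + zmodTrigPoly n S c (m * g) := fun m g => by
    rw [hF, ← Finset.add_sum_erase _ _ (show (0 : ℤ) ∈ Finset.Icc (-(H : ℤ)) H by simp),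
      zmodTrigPoly]
    congr 1
    · simp
    refine Finset.sum_congr rfl fun h _ => ?_
    have hcast : (h : ZMod n) * (m * (g : ZMod n))
        = ((h * (m * ((g : ZMod n).val : ℤ)) : ℤ) : ZMod n) := by
      push_cast
      rw [ZMod.natCast_zmod_val]
    rw [hcast, ZMod.stdAddChar_coe]
    congr 2
    push_cast
    ring
  have hneg : ∀ (m : ℤ) (g : (ZMod n)ˣ), zmodTrigPoly n S c (m * ((-g : (ZMod n)ˣ) : ZMod n))
      = -zmodTrigPoly n S c (m * g) := fun m g => by
    rw [Units.val_neg, mul_neg, zmodTrigPoly_neg hS hc]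
  have hlin : ∀ m : ℤ, ∑ g : (ZMod n)ˣ, zmodTrigPoly n S c (m * g) = 0 := fun m =>
    sum_units_eq_zero_of_odd (hneg m)
  have hcub : ∑ g : (ZMod n)ˣ, zmodTrigPoly n S c (a * g) * zmodTrigPoly n S c (b * g) *
      zmodTrigPoly n S c ((1 : ℤ) * g) = 0 :=
    sum_units_eq_zero_of_odd fun g => by
      simp only [hneg]
      ring
  have hbc := sum_units_zmodTrigPoly_mul n S c b 1
  have hac := sum_units_zmodTrigPoly_mul n S c a 1
  have hab := sum_units_zmodTrigPoly_mul n S c a b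
  simp only [one_mul] at hbc hac
  simp_rw [mul_comm (c (Prod.snd _)) (c (Prod.fst _))]
  rw [← hbc, ← hac, ← hab]
  have hone : ∀ g : (ZMod n)ˣ, F (((g : ZMod n).val : ℝ) / n)
      = c 0 + zmodTrigPoly n S c ((1 : ℤ) * g) := fun g => by
    rw [← hFG, Int.cast_one, one_mul]
  have hexpand : ∀ x y z w : ℂ, (w + x) * (w + y) * (w + z)
      = w ^ 3 + w ^ 2 * x + w ^ 2 * y + w ^ 2 * z + w * (y * z) + w * (x * z) + w * (x * y)
        + x * y * z := fun x y z w => by ring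
  simp_rw [hFG, hone, hexpand, Finset.sum_add_distrib, ← Finset.mul_sum, hlin, hcub]
  rw [Finset.sum_const, Finset.card_univ, ZMod.card_units_eq_totient, nsmul_eq_mul]
  ring
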